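/- Let m ≥ 2 and n ≥ 1. The boundary ∂ of the integral Yang–Baxter chain complex of the cyclic biquandle C_m maps the degenerate subgroup D_n into D_{n−1}, and the n-th degenerate set-theoretic Yang–Baxter homology group of C_m, i.e. the homology ker(∂_n|_{D_n}) / ∂_{n+1}(D_{n+1}) of the subcomplex (D_n, ∂), has rank m^{n−1} − (m−1)^{n−1} as an abelian group. -/

import Mathlib

/-- The `i`-th left face map of the set-theoretic Yang–Baxter (co)chain complex of the
cyclic biquandle `C_m = ℤ/mℤ` (with `R(a,b) = (b+1, a-1)`): it drops the `i`-th coordinate,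
subtracting `1` from all earlier coordinates. -/
def dl (m n : ℕ) (i : Fin (n + 1)) (x : Fin (n + 1) → ZMod m) : Fin n → ZMod m :=
  fun j => if (j : ℕ) < (i : ℕ) then x j.castSucc - 1 else x j.succ

/-- The `i`-th right face map: it drops the `i`-th coordinate, adding `1` to all later
coordinates. -/
def dr (m n : ℕ) (i : Fin (n + 1)) (x : Fin (n + 1) → ZMod m) : Fin n → ZMod m :=
  fun j => if (j : ℕ) < (i : ℕ) then x j.castSucc else x j.succ + 1

/-- The Yang–Baxter coboundary `δⁿ` of the cyclic biquandle `C_m` with coefficients in an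
abelian group `A`:
`(δⁿ f)(x₁,…,x_{n+1}) = Σᵢ (−1)^{i−1} [f(x₁−1,…,x_{i−1}−1,x_{i+1},…) − f(x₁,…,x_{i−1},x_{i+1}+1,…)]`. -/
def delta {A : Type*} [AddCommGroup A] (m n : ℕ) (f : (Fin n → ZMod m) → A) :
    (Fin (n + 1) → ZMod m) → A :=
  fun x => ∑ i : Fin (n + 1), (-1 : ℤ) ^ (i : ℕ) • (f (dl m n i x) - f (dr m n i x))

/-- The diagonal shift operator `S` on cochains: `(Sf)(x₁,…,x_k) = f(x₁−1,…,x_k−1)`. -/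
def shiftC {A : Type*} (m k : ℕ) (f : (Fin k → ZMod m) → A) : (Fin k → ZMod m) → A :=
  fun x => f fun j => x j - 1

/-- The set-theoretic Yang–Baxter boundary `∂ : C_{n+1} → C_n` of the cyclic biquandle
`C_m`, where `C_k` is the free `ℤ`-module on `(ℤ/m)^k`; on a generator `x`,
`∂x = Σᵢ (−1)^{i−1} [(x₁−1,…,x_{i−1}−1,x_{i+1},…) − (x₁,…,x_{i−1},x_{i+1}+1,…)]`. -/
noncomputable def bnd (m n : ℕ) :
    ((Fin (n + 1) → ZMod m) →₀ ℤ) →ₗ[ℤ] ((Fin n → ZMod m) →₀ ℤ) :=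
  Finsupp.linearCombination ℤ fun x =>
    ∑ i : Fin (n + 1), (-1 : ℤ) ^ (i : ℕ) •
      (Finsupp.single (dl m n i x) 1 - Finsupp.single (dr m n i x) 1)


/-- A tuple `(x₁,…,x_k)` in `(ℤ/m)^k` is degenerate if `x_i = x_{i+1} + 1` for some pair of
consecutive indices (these are the fixed points of the Yang–Baxter operator
`R(a,b) = (b+1, a−1)`). -/
def IsDeg (m k : ℕ) (x : Fin k → ZMod m) : Prop :=
  ∃ i j : Fin k, (j : ℕ) = (i : ℕ) + 1 ∧ x i = x j + 1

/-- The degenerate subgroup `D_k ⊆ C_k`: the subgroup spanned by the degenerate tuples. -/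
noncomputable def Dsub (m k : ℕ) : Submodule ℤ ((Fin k → ZMod m) →₀ ℤ) :=
  Submodule.span ℤ ((fun x => Finsupp.single x (1 : ℤ)) '' {x | IsDeg m k x})

namespace CyclicBiquandle

/-- The chain group `C_k`. -/
abbrev Chain (m k : ℕ) : Type := (Fin k → ZMod m) →₀ ℤ

/-- The diagonal shift on tuples. -/
def tupleShift (m k : ℕ) (x : Fin k → ZMod m) : Fin k → ZMod m := fun j => x j - 1

/-- The diagonal shift on chains. -/
noncomputable def shift (m k : ℕ) : Module.End ℤ (Chain m k) :=
  Finsupp.lmapDomain ℤ ℤ (tupleShift m k)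

/-- The alternating sum of the right faces. -/
noncomputable def rightBnd (m n : ℕ) : Chain m (n + 1) →ₗ[ℤ] Chain m n :=
  Finsupp.linearCombination ℤ fun x =>
    ∑ i : Fin (n + 1), (-1 : ℤ) ^ (i : ℕ) • Finsupp.single (dr m n i x) 1

/-- The cone on tuples with apex `0`. -/
def tupleCone (m k : ℕ) (x : Fin k → ZMod m) : Fin (k + 1) → ZMod m :=
  Fin.cons 0 (tupleShift m k x)

/-- The cone on chains, a contracting homotopy for `rightBnd`. -/
noncomputable def cone (m k : ℕ) : Chain m k →ₗ[ℤ] Chain m (k + 1) :=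
  Finsupp.lmapDomain ℤ ℤ (tupleCone m k)

/-- The norm element `1 + S + ⋯ + S ^ (m - 1)` of the shift `S`. -/
noncomputable def norm (m k : ℕ) : Module.End ℤ (Chain m k) :=
  ∑ j ∈ Finset.range m, shift m k ^ j

/-- The shift-invariant degenerate chains. -/
noncomputable def invariants (m k : ℕ) : Submodule ℤ (Chain m k) :=
  LinearMap.ker (shift m k - 1) ⊓ Dsub m k

lemma shift_single (m k : ℕ) (x : Fin k → ZMod m) (a : ℤ) :
    shift m k (Finsupp.single x a) = Finsupp.single (tupleShift m k x) a := by
  simp [shift]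

lemma cone_single (m k : ℕ) (x : Fin k → ZMod m) (a : ℤ) :
    cone m k (Finsupp.single x a) = Finsupp.single (tupleCone m k x) a := by
  simp [cone]

lemma rightBnd_single (m n : ℕ) (x : Fin (n + 1) → ZMod m) :
    rightBnd m n (Finsupp.single x 1) =
      ∑ i : Fin (n + 1), (-1 : ℤ) ^ (i : ℕ) • Finsupp.single (dr m n i x) 1 := by
  simp [rightBnd]

lemma tupleShift_dr (m n : ℕ) (i : Fin (n + 1)) (x : Fin (n + 1) → ZMod m) :
    tupleShift m n (dr m n i x) = dl m n i x := by
  funext j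
  simp only [tupleShift, dr, dl]
  split_ifs <;> ring

lemma dr_tupleShift (m n : ℕ) (i : Fin (n + 1)) (x : Fin (n + 1) → ZMod m) :
    dr m n i (tupleShift m (n + 1) x) = tupleShift m n (dr m n i x) := by
  funext j
  simp only [tupleShift, dr]
  split_ifs <;> ring

lemma dr_zero_tupleCone (m k : ℕ) (x : Fin k → ZMod m) :
    dr m k 0 (tupleCone m k x) = x := by
  funext j
  simp [dr, tupleCone, tupleShift]

lemma dr_succ_tupleCone (m k : ℕ) (i : Fin (k + 1)) (x : Fin (k + 1) → ZMod m) :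
    dr m (k + 1) i.succ (tupleCone m (k + 1) x) = tupleCone m k (dr m k i x) := by
  funext j
  refine Fin.cases ?_ (fun j => ?_) j
  · simp [dr, tupleCone]
  · simp only [dr, tupleCone, Fin.val_succ, Fin.cons_succ, Fin.castSucc_succ, tupleShift,
      add_lt_add_iff_right]
    split_ifs <;> ring

lemma bnd_eq (m n : ℕ) : bnd m n = (shift m n - 1) ∘ₗ rightBnd m n := by
  refine Finsupp.lhom_ext' fun x => LinearMap.ext_ring ?_
  simp [bnd, rightBnd_single, shift_single, tupleShift_dr, smul_sub, Finset.sum_sub_distrib]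

lemma shift_rightBnd (m n : ℕ) (z : Chain m (n + 1)) :
    shift m n (rightBnd m n z) = rightBnd m n (shift m (n + 1) z) := by
  suffices h : shift m n ∘ₗ rightBnd m n = rightBnd m n ∘ₗ shift m (n + 1) from
    LinearMap.congr_fun h z
  refine Finsupp.lhom_ext' fun x => LinearMap.ext_ring ?_
  simp [rightBnd_single, shift_single, dr_tupleShift]

lemma shift_pow_rightBnd (m n j : ℕ) (z : Chain m (n + 1)) :
    (shift m n ^ j) (rightBnd m n z) = rightBnd m n ((shift m (n + 1) ^ j) z) := by
  induction j with
  | zero => simp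
  | succ j ih => rw [pow_succ', pow_succ', Module.End.mul_apply, ih, shift_rightBnd,
      Module.End.mul_apply]

lemma norm_rightBnd (m n : ℕ) (z : Chain m (n + 1)) :
    norm m n (rightBnd m n z) = rightBnd m n (norm m (n + 1) z) := by
  simp [norm, LinearMap.sum_apply, shift_pow_rightBnd]

lemma rightBnd_cone (m n : ℕ) (z : Chain m (n + 1)) :
    rightBnd m (n + 1) (cone m (n + 1) z) + cone m n (rightBnd m n z) = z := by
  suffices h : rightBnd m (n + 1) ∘ₗ cone m (n + 1) + cone m n ∘ₗ rightBnd m n =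
      LinearMap.id from LinearMap.congr_fun h z
  refine Finsupp.lhom_ext' fun x => LinearMap.ext_ring ?_
  simp [rightBnd_single, cone_single, Fin.sum_univ_succ (n := n + 1), dr_zero_tupleCone,
    dr_succ_tupleCone, pow_succ]

lemma shift_pow_card (m k : ℕ) : shift m k ^ m = 1 := by
  have key : ∀ (j : ℕ) (x : Fin k → ZMod m),
      (shift m k ^ j) (Finsupp.single x 1) = Finsupp.single (fun i => x i - (j : ZMod m)) 1 := by
    intro j x
    induction j with
    | zero => simp
    | succ j ih =>
      rw [pow_succ', Module.End.mul_apply, ih, shift_single]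
      congr 1
      funext i
      simp only [tupleShift]
      push_cast
      ring
  refine Finsupp.lhom_ext' fun x => LinearMap.ext_ring ?_
  simp [key]

lemma shift_norm (m k : ℕ) (z : Chain m k) : shift m k (norm m k z) = norm m k z := by
  have h : (shift m k - 1) * norm m k = 0 := by
    rw [norm, mul_geom_sum, shift_pow_card, sub_self]
  simpa [sub_eq_zero] using LinearMap.congr_fun h z

lemma norm_shift (m k : ℕ) (z : Chain m k) : norm m k (shift m k z) = norm m k z := by
  have h : norm m k * (shift m k - 1) = 0 := by
    rw [norm, geom_sum_mul, shift_pow_card, sub_self]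
  simpa [sub_eq_zero] using LinearMap.congr_fun h z

lemma norm_of_shift_eq {m k : ℕ} {z : Chain m k} (h : shift m k z = z) :
    norm m k z = (m : ℤ) • z := by
  have hp : ∀ j : ℕ, (shift m k ^ j) z = z := by
    intro j
    induction j with
    | zero => simp
    | succ j ih => rw [pow_succ, Module.End.mul_apply, h, ih]
  simp [norm, LinearMap.sum_apply, hp]

lemma mem_Dsub_iff {m k : ℕ} {z : Chain m k} :
    z ∈ Dsub m k ↔ ∀ x, ¬ IsDeg m k x → z x = 0 := by
  rw [Dsub, ← Finsupp.supported_eq_span_single, Finsupp.mem_supported']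
  rfl

lemma single_mem_Dsub {m k : ℕ} {x : Fin k → ZMod m} (h : IsDeg m k x) :
    (Finsupp.single x 1 : Chain m k) ∈ Dsub m k :=
  Submodule.subset_span ⟨x, h, rfl⟩

lemma map_mem_Dsub {m k l : ℕ} (f : Chain m k →ₗ[ℤ] Chain m l)
    (hf : ∀ x, IsDeg m k x → f (Finsupp.single x 1) ∈ Dsub m l) {z : Chain m k}
    (hz : z ∈ Dsub m k) : f z ∈ Dsub m l := by
  have h : Dsub m k ≤ (Dsub m l).comap f := by
    rw [Dsub, Submodule.span_le]
    rintro _ ⟨x, hx, rfl⟩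
    exact hf x hx
  exact h hz

lemma shift_mem_Dsub {m k : ℕ} {z : Chain m k} (hz : z ∈ Dsub m k) :
    shift m k z ∈ Dsub m k := by
  refine map_mem_Dsub _ (fun x hx => ?_) hz
  rw [shift_single]
  obtain ⟨i, j, hij, h⟩ := hx
  exact single_mem_Dsub ⟨i, j, hij, by simp [tupleShift, h]⟩

lemma shift_pow_mem_Dsub {m k : ℕ} (j : ℕ) {z : Chain m k} (hz : z ∈ Dsub m k) :
    (shift m k ^ j) z ∈ Dsub m k := by
  induction j with
  | zero => simpa
  | succ j ih => rw [pow_succ', Module.End.mul_apply]; exact shift_mem_Dsub ih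

lemma norm_mem_Dsub {m k : ℕ} {z : Chain m k} (hz : z ∈ Dsub m k) :
    norm m k z ∈ Dsub m k := by
  rw [norm, LinearMap.sum_apply]
  exact Submodule.sum_mem _ fun j _ => shift_pow_mem_Dsub j hz

lemma cone_mem_Dsub {m k : ℕ} {z : Chain m k} (hz : z ∈ Dsub m k) :
    cone m k z ∈ Dsub m (k + 1) := by
  refine map_mem_Dsub _ (fun x hx => ?_) hz
  rw [cone_single]
  obtain ⟨i, j, hij, h⟩ := hx
  exact single_mem_Dsub ⟨i.succ, j.succ, by simp [hij], by simp [tupleCone, tupleShift, h]⟩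

lemma isDeg_dr {m n : ℕ} {x : Fin (n + 1) → ZMod m} {a b : Fin (n + 1)}
    (hab : (b : ℕ) = a + 1) (h : x a = x b + 1) {i : Fin (n + 1)} (ha : i ≠ a) (hb : i ≠ b) :
    IsDeg m n (dr m n i x) := by
  obtain ⟨a, hal⟩ := a
  obtain ⟨b, hbl⟩ := b
  obtain ⟨i, hil⟩ := i
  simp only [ne_eq, Fin.mk.injEq] at hab ha hb
  subst hab
  rcases lt_or_gt_of_ne ha with hlt | hgt
  · refine ⟨⟨a - 1, by omega⟩, ⟨a, by omega⟩, by simp; omega, ?_⟩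
    have h1 : ¬ a - 1 < i := by omega
    have h2 : ¬ a < i := by omega
    have h3 : a - 1 + 1 = a := by omega
    simp [dr, h1, h2, h3, h]
  · refine ⟨⟨a, by omega⟩, ⟨a + 1, by omega⟩, by simp, ?_⟩
    have h1 : a < i := by omega
    have h2 : a + 1 < i := by omega
    simp [dr, h1, h2, h]

lemma dr_eq_dr {m n : ℕ} {x : Fin (n + 1) → ZMod m} {a b : Fin (n + 1)}
    (hab : (b : ℕ) = a + 1) (h : x a = x b + 1) : dr m n a x = dr m n b x := by
  funext j
  simp only [dr]
  rcases lt_trichotomy (j : ℕ) a with hj | hj | hj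
  · rw [if_pos hj, if_pos (by omega)]
  · rw [if_neg (by omega), if_pos (by omega)]
    have h1 : j.castSucc = a := Fin.ext hj
    have h2 : j.succ = b := Fin.ext (by simp; omega)
    rw [h1, h2, h]
  · rw [if_neg (by omega), if_neg (by omega)]

lemma rightBnd_mem_Dsub {m n : ℕ} {z : Chain m (n + 1)} (hz : z ∈ Dsub m (n + 1)) :
    rightBnd m n z ∈ Dsub m n := by
  refine map_mem_Dsub _ (fun x hx => ?_) hz
  obtain ⟨a, b, hab, h⟩ := hx
  have hne : b ≠ a := fun hba => by rw [hba] at hab; omega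
  rw [rightBnd_single, ← Finset.add_sum_erase _ _ (Finset.mem_univ a),
    ← Finset.add_sum_erase _ _ (Finset.mem_erase.2 ⟨hne, Finset.mem_univ b⟩), ← add_assoc,
    dr_eq_dr hab h, hab, pow_succ, mul_neg_one, neg_smul, add_neg_cancel, zero_add]
  refine Submodule.sum_mem _ fun i hi => Submodule.smul_mem _ _ (single_mem_Dsub ?_)
  simp only [Finset.mem_erase, Finset.mem_univ, and_true] at hi
  exact isDeg_dr hab h hi.2 hi.1

lemma bnd_mem_Dsub {m n : ℕ} {z : Chain m (n + 1)} (hz : z ∈ Dsub m (n + 1)) :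
    bnd m n z ∈ Dsub m n := by
  rw [bnd_eq]
  exact Submodule.sub_mem _ (shift_mem_Dsub (rightBnd_mem_Dsub hz)) (rightBnd_mem_Dsub hz)

lemma mem_ker_bnd_iff {m n : ℕ} {z : Chain m (n + 1)} :
    z ∈ LinearMap.ker (bnd m n) ↔ shift m n (rightBnd m n z) = rightBnd m n z := by
  simp [bnd_eq, sub_eq_zero]

lemma mem_invariants_iff {m k : ℕ} {z : Chain m k} :
    z ∈ invariants m k ↔ shift m k z = z ∧ z ∈ Dsub m k := by
  simp [invariants, sub_eq_zero]

lemma norm_bnd (m n : ℕ) (w : Chain m (n + 1)) : norm m n (bnd m n w) = 0 := by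
  simp [bnd_eq, norm_shift]

lemma invariants_le_cycles (m n : ℕ) :
    invariants m (n + 1) ≤ LinearMap.ker (bnd m n) ⊓ Dsub m (n + 1) := by
  intro z hz
  rw [mem_invariants_iff] at hz
  exact ⟨mem_ker_bnd_iff.2 (by rw [shift_rightBnd, hz.1]), hz.2⟩

lemma norm_mem_invariants {m k : ℕ} {z : Chain m k} (hz : z ∈ Dsub m k) :
    norm m k z ∈ invariants m k :=
  mem_invariants_iff.2 ⟨shift_norm m k z, norm_mem_Dsub hz⟩

lemma shift_pow_sub_mem_boundaries {m n : ℕ} (j : ℕ) {w : Chain m (n + 1)}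
    (hw : w ∈ Dsub m (n + 1)) :
    (shift m n ^ j) (rightBnd m n w) - rightBnd m n w ∈
      Submodule.map (bnd m n) (Dsub m (n + 1)) := by
  induction j with
  | zero => simp
  | succ j ih =>
    have h : bnd m n ((shift m (n + 1) ^ j) w) =
        (shift m n ^ (j + 1)) (rightBnd m n w) - (shift m n ^ j) (rightBnd m n w) := by
      rw [bnd_eq, LinearMap.comp_apply, ← shift_pow_rightBnd, pow_succ']
      rfl
    rw [← sub_add_sub_cancel _ ((shift m n ^ j) (rightBnd m n w)), ← h]
    exact Submodule.add_mem _ ⟨_, shift_pow_mem_Dsub j hw, rfl⟩ ih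

lemma smul_mem_boundaries {m n : ℕ} [NeZero m] {z : Chain m (n + 1)}
    (hk : z ∈ LinearMap.ker (bnd m n)) (hz : z ∈ Dsub m (n + 1))
    (hN : norm m (n + 1) z = 0) :
    (m : ℤ) • z ∈ Submodule.map (bnd m (n + 1)) (Dsub m (n + 2)) := by
  have h0 : rightBnd m n z = 0 := by
    have h1 := norm_of_shift_eq (mem_ker_bnd_iff.1 hk)
    rw [norm_rightBnd, hN, map_zero] at h1
    exact (smul_eq_zero.1 h1.symm).resolve_left (by exact_mod_cast NeZero.ne m)
  have h1 : rightBnd m (n + 1) (cone m (n + 1) z) = z := by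
    simpa [h0] using rightBnd_cone m n z
  have h2 : (m : ℤ) • z = -∑ j ∈ Finset.range m, ((shift m (n + 1) ^ j) z - z) := by
    rw [norm, LinearMap.sum_apply] at hN
    simp [Finset.sum_sub_distrib, hN]
  rw [h2]
  refine Submodule.neg_mem _ (Submodule.sum_mem _ fun j _ => ?_)
  have h3 := shift_pow_sub_mem_boundaries j (cone_mem_Dsub hz)
  rwa [h1] at h3

lemma shift_apply (m k : ℕ) (z : Chain m k) (x : Fin k → ZMod m) :
    shift m k z (tupleShift m k x) = z x := by
  refine Finsupp.mapDomain_apply (fun a b h => ?_) z x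
  funext i
  simpa [tupleShift] using congrFun h i

lemma shift_eq_iff {m k : ℕ} {z : Chain m k} :
    shift m k z = z ↔ ∀ x, z (tupleShift m k x) = z x := by
  constructor
  · intro h x
    rw [← shift_apply m k z x, h]
  · intro h
    ext x
    have hx : tupleShift m k (fun i => x i + 1) = x := by
      funext i
      simp [tupleShift]
    rw [← hx, shift_apply, h]

lemma apply_sub_of_shift_eq {m k : ℕ} [NeZero m] {z : Chain m k} (h : shift m k z = z)
    (c : ZMod m) (x : Fin k → ZMod m) : z (fun i => x i - c) = z x := by
  rw [← ZMod.natCast_zmod_val c]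
  generalize c.val = j
  induction j with
  | zero => simp
  | succ j ih =>
    rw [← ih, ← shift_eq_iff.1 h (fun i => x i - (j : ZMod m))]
    congr 1
    funext i
    simp only [tupleShift]
    push_cast
    ring

/-- The consecutive differences of a tuple, normalised to vanish exactly at the degenerate
positions. -/
def diff (m n : ℕ) (x : Fin (n + 1) → ZMod m) : Fin n → ZMod m :=
  fun i => x i.castSucc - x i.succ - 1

/-- The tuple with first entry `0` and prescribed consecutive differences. -/
def ofDiff (m n : ℕ) (d : Fin n → ZMod m) : Fin (n + 1) → ZMod m :=
  Fin.partialSum fun i => -1 - d i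

lemma diff_ofDiff (m n : ℕ) (d : Fin n → ZMod m) : diff m n (ofDiff m n d) = d := by
  funext i
  simp only [diff, ofDiff, Fin.partialSum_succ]
  ring

lemma ofDiff_diff (m n : ℕ) (x : Fin (n + 1) → ZMod m) :
    ofDiff m n (diff m n x) = fun i => x i - x 0 := by
  funext i
  induction i using Fin.induction with
  | zero => simp [ofDiff]
  | succ i ih =>
    simp only [ofDiff, Fin.partialSum_succ] at ih ⊢
    rw [ih, diff]
    ring

lemma diff_tupleShift (m n : ℕ) (x : Fin (n + 1) → ZMod m) :
    diff m n (tupleShift m (n + 1) x) = diff m n x := by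
  funext i
  simp [diff, tupleShift]

lemma isDeg_iff_diff {m n : ℕ} {x : Fin (n + 1) → ZMod m} :
    IsDeg m (n + 1) x ↔ ∃ i, diff m n x i = 0 := by
  constructor
  · rintro ⟨a, b, hab, h⟩
    have ha : (a : ℕ) < n := by omega
    refine ⟨⟨a, ha⟩, ?_⟩
    have h1 : (⟨a, ha⟩ : Fin n).castSucc = a := rfl
    have h2 : (⟨a, ha⟩ : Fin n).succ = b := Fin.ext (by simp [hab])
    rw [diff, h1, h2, h]
    ring
  · rintro ⟨i, hi⟩
    refine ⟨i.castSucc, i.succ, by simp, ?_⟩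
    rw [diff, sub_sub, sub_eq_zero] at hi
    exact hi

open Classical in
/-- The invariant degenerate chain with prescribed coefficients on difference tuples. -/
noncomputable def ofCoeff (m n : ℕ) [NeZero m] :
    ({d : Fin n → ZMod m // ∃ i, d i = 0} → ℤ) →ₗ[ℤ] Chain m (n + 1) where
  toFun F := Finsupp.equivFunOnFinite.symm fun x =>
    if h : ∃ i, diff m n x i = 0 then F ⟨diff m n x, h⟩ else 0
  map_add' F G := by
    ext x
    by_cases h : ∃ i, diff m n x i = 0 <;> simp [h]
  map_smul' c F := by
    ext x
    by_cases h : ∃ i, diff m n x i = 0 <;> simp [h]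

open Classical in
lemma ofCoeff_apply (m n : ℕ) [NeZero m] (F : {d : Fin n → ZMod m // ∃ i, d i = 0} → ℤ)
    (x : Fin (n + 1) → ZMod m) : ofCoeff m n F x =
      if h : ∃ i, diff m n x i = 0 then F ⟨diff m n x, h⟩ else 0 := rfl

lemma ofCoeff_injective (m n : ℕ) [NeZero m] : Function.Injective (ofCoeff m n) := by
  intro F G h
  funext ⟨d, hd⟩
  have h1 := DFunLike.congr_fun h (ofDiff m n d)
  simpa only [ofCoeff_apply, diff_ofDiff, hd, dite_true] using h1

lemma range_ofCoeff (m n : ℕ) [NeZero m] :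
    LinearMap.range (ofCoeff m n) = invariants m (n + 1) := by
  ext z
  rw [mem_invariants_iff]
  constructor
  · rintro ⟨F, rfl⟩
    refine ⟨shift_eq_iff.2 fun x => ?_, mem_Dsub_iff.2 fun x hx => ?_⟩
    · simp only [ofCoeff_apply, diff_tupleShift]
    · rw [ofCoeff_apply, dif_neg (isDeg_iff_diff.not.1 hx)]
  · rintro ⟨h, hz⟩
    refine ⟨fun d => z (ofDiff m n d), ?_⟩
    ext x
    rw [ofCoeff_apply]
    split_ifs with hx
    · rw [ofDiff_diff, apply_sub_of_shift_eq h]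
    · exact (mem_Dsub_iff.1 hz x (isDeg_iff_diff.not.2 hx)).symm

lemma card_exists_eq_zero (m n : ℕ) [NeZero m] :
    Nat.card {d : Fin n → ZMod m // ∃ i, d i = 0} = m ^ n - (m - 1) ^ n := by
  classical
  have h := Fintype.card_subtype_compl fun d : Fin n → ZMod m => ∀ i, d i ≠ 0
  have h1 : Fintype.card {d : Fin n → ZMod m // ∀ i, d i ≠ 0} = (m - 1) ^ n := by
    rw [Fintype.card_congr (Equiv.subtypePiEquivPi (p := fun _ a => a ≠ 0)), Fintype.card_pi]
    simp [Fintype.card_subtype_compl, ZMod.card]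
  rw [h1, Fintype.card_fun, ZMod.card, Fintype.card_fin] at h
  rw [← h, ← Nat.card_eq_fintype_card]
  exact Nat.card_congr (Equiv.subtypeEquivRight fun d => by simp)

lemma finrank_invariants (m n : ℕ) [NeZero m] :
    Module.finrank ℤ (invariants m (n + 1)) = m ^ n - (m - 1) ^ n := by
  classical
  rw [← range_ofCoeff, LinearMap.finrank_range_of_inj (ofCoeff_injective m n),
    Module.finrank_fintype_fun_eq_card, ← Nat.card_eq_fintype_card, card_exists_eq_zero]

lemma finrank_eq_of_torsion_ker {M I : Type*} [AddCommGroup M] [AddCommGroup I]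
    [Module.Finite ℤ M] [Module.Finite ℤ I] [Module.IsTorsionFree ℤ I] (f : M →ₗ[ℤ] I)
    (a : ℤ) (ha : a ≠ 0) (hker : ∀ x, f x = 0 → a • x = 0)
    (hrange : ∀ y, a • y ∈ LinearMap.range f) : Module.finrank ℤ M = Module.finrank ℤ I := by
  have h1 := (LinearMap.ker f).finrank_quotient_add_finrank
  have h2 : Module.finrank ℤ (LinearMap.ker f) = 0 :=
    Module.finrank_eq_zero_iff.2 fun x => ⟨a, ha, Subtype.ext (hker x x.2)⟩
  rw [h2, add_zero, f.quotKerEquivRange.finrank_eq] at h1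
  rw [← h1]
  refine le_antisymm (Submodule.finrank_le _) ?_
  refine LinearMap.finrank_le_finrank_of_injective
    (f := (LinearMap.lsmul ℤ I a).codRestrict (LinearMap.range f) hrange) fun x y h => ?_
  exact smul_right_injective I ha (congrArg Subtype.val h)

lemma finrank_homology (m n : ℕ) [NeZero m] :
    Module.finrank ℤ
      (↥(LinearMap.ker (bnd m n) ⊓ Dsub m (n + 1)) ⧸
        Submodule.comap (LinearMap.ker (bnd m n) ⊓ Dsub m (n + 1)).subtype
          (Submodule.map (bnd m (n + 1)) (Dsub m (n + 2)))) =
    Module.finrank ℤ (invariants m (n + 1)) := by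
  have hm : (m : ℤ) ≠ 0 := by exact_mod_cast NeZero.ne m
  set K := LinearMap.ker (bnd m n) ⊓ Dsub m (n + 1) with hK
  set B := Submodule.comap K.subtype (Submodule.map (bnd m (n + 1)) (Dsub m (n + 2))) with hB
  let g : K →ₗ[ℤ] invariants m (n + 1) :=
    (norm m (n + 1) ∘ₗ K.subtype).codRestrict _ fun z => norm_mem_invariants z.2.2
  have hg : B ≤ LinearMap.ker g := by
    rintro z ⟨w, -, hw⟩
    refine Subtype.ext ?_
    change norm m (n + 1) z = 0
    have hw' : bnd m (n + 1) w = z := hw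
    rw [← hw', norm_bnd]
  refine finrank_eq_of_torsion_ker (B.liftQ g hg) m hm (fun x hx => ?_) fun y => ?_
  · obtain ⟨z, rfl⟩ := B.mkQ_surjective x
    rw [Submodule.mkQ_apply, Submodule.liftQ_apply] at hx
    rw [← map_smul, Submodule.mkQ_apply, Submodule.Quotient.mk_eq_zero]
    exact smul_mem_boundaries z.2.1 z.2.2 (congrArg Subtype.val hx)
  · refine ⟨B.mkQ ⟨y, invariants_le_cycles m n y.2⟩, ?_⟩
    rw [Submodule.mkQ_apply, Submodule.liftQ_apply]
    exact Subtype.ext (norm_of_shift_eq (mem_invariants_iff.1 y.2).1)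

end CyclicBiquandle

/-- the Yang–Baxter boundary of the cyclic biquandle `C_m` maps the degenerate
subgroup `D_n` into `D_{n−1}`, and the `n`-th degenerate set-theoretic Yang–Baxter homology
group `ker(∂_n|_{D_n}) / ∂_{n+1}(D_{n+1})` has rank `m^{n−1} − (m−1)^{n−1}` as an abelian
group. (The degree `n ≥ 1` is realized as `n+1` with `n : ℕ` arbitrary, so the rank reads
`m^n − (m−1)^n`.) -/
theorem rank_degenerate_YB_homology_cyclic_biquandle (m n : ℕ) (hm : 2 ≤ m) :
    (∀ k : ℕ, Submodule.map (bnd m k) (Dsub m (k + 1)) ≤ Dsub m k) ∧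
    Module.finrank ℤ
      (↥(LinearMap.ker (bnd m n) ⊓ Dsub m (n + 1)) ⧸
        Submodule.comap (LinearMap.ker (bnd m n) ⊓ Dsub m (n + 1)).subtype
          (Submodule.map (bnd m (n + 1)) (Dsub m (n + 2)))) = m ^ n - (m - 1) ^ n := by
  have : NeZero m := ⟨by omega⟩
  refine ⟨fun k => ?_, ?_⟩
  · rintro _ ⟨z, hz, rfl⟩
    exact CyclicBiquandle.bnd_mem_Dsub hz
  · rw [CyclicBiquandle.finrank_homology, CyclicBiquandle.finrank_invariants]
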